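/- Let d ≥ 3 and g(x) = |x|^{2-d} on ℝ^d. Assume V : ℝ^d → ℝ ∪ {+∞} is lower semi-continuous, bounded below, finite on a set of positive Lebesgue measure, and satisfies lim_{|x|→∞} (V(x)/2 + g(x)) = +∞. Let μ_V be the unique minimizer of I_V over probability measures on ℝ^d, let h(x) = ∫ g(x-y) dμ_V(y) be its potential, and set c = I_V(μ_V) - (1/2)∫ V dμ_V. Then h + V/2 ≥ c Lebesgue-almost everywhere on ℝ^d, and h + V/2 = c μ_V-almost everywhere. -/

import Mathlib

open MeasureTheory Filter Topology
open scoped ENNReal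

noncomputable section

/-- The ambient Euclidean space `ℝ^d`. -/
abbrev Esp (d : ℕ) := EuclideanSpace ℝ (Fin d)

/-- The Coulomb kernel `g(x) = |x|^(2-d)` in dimension `d ≥ 3`, with values in `[0,∞]`
(it equals `+∞` at the origin, since `2 - d < 0`). -/
def coulK (d : ℕ) (x : Esp d) : ℝ≥0∞ := (ENNReal.ofReal ‖x‖) ^ (2 - (d : ℝ))

/-- The Coulomb interaction energy `∬ g(x-y) dμ(x) dμ(y) ∈ [0,∞]`. -/
def doubleEnergy (d : ℕ) (μ : Measure (Esp d)) : ℝ≥0∞ :=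
  ∫⁻ p : Esp d × Esp d, coulK d (p.1 - p.2) ∂(μ.prod μ)

/-- The integral of an extended-real-valued function, defined as the (extended-real)
difference of the integrals of the positive and negative parts. -/
def eIntE {α : Type*} [MeasurableSpace α] (μ : Measure α) (f : α → EReal) : EReal :=
  ((∫⁻ x, (if f x = ⊤ then ⊤ else ENNReal.ofReal (f x).toReal) ∂μ : ℝ≥0∞) : EReal)
    - ((∫⁻ x, (if f x = ⊥ then ⊤ else ENNReal.ofReal (-(f x)).toReal) ∂μ : ℝ≥0∞) : EReal)

/-- The mean-field energy functional `I_V(μ) = ∬ g(x-y) dμ(x)dμ(y) + ∫ V dμ`,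
with values in `(-∞, +∞]` (for `V` bounded below), for the Coulomb kernel in dimension `d ≥ 3`. -/
def IV (d : ℕ) (V : Esp d → EReal) (μ : Measure (Esp d)) : EReal :=
  (doubleEnergy d μ : EReal) + eIntE μ V

/-- The electrostatic potential `h^{μ}(x) = ∫ g(x-y) dμ(y) ∈ [0,∞]` generated by `μ`. -/
def potC (d : ℕ) (μ : Measure (Esp d)) (x : Esp d) : ℝ≥0∞ :=
  ∫⁻ y, coulK d (x - y) ∂μ

/-- The mutual energy `∬ k(x,y) dν(y) dμ(x)` of two measures for a kernel `k`. -/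
def mutualEnergy {X : Type*} [MeasurableSpace X] (k : X → X → ℝ≥0∞) (μ ν : Measure X) : ℝ≥0∞ :=
  ∫⁻ x, ∫⁻ y, k x y ∂ν ∂μ

section MutualEnergy

variable {X : Type*} [MeasurableSpace X] {k : X → X → ℝ≥0∞}

lemma mutualEnergy_comm (hk : Measurable (Function.uncurry k)) (hsymm : ∀ x y, k x y = k y x)
    (μ ν : Measure X) [SFinite μ] [SFinite ν] : mutualEnergy k μ ν = mutualEnergy k ν μ := by
  unfold mutualEnergy
  rw [lintegral_lintegral_swap hk.aemeasurable]
  simp_rw [hsymm]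

lemma mutualEnergy_smul_smul (hk : Measurable (Function.uncurry k)) (a b : ℝ≥0∞)
    (μ ν : Measure X) [SFinite ν] :
    mutualEnergy k (a • μ) (b • ν) = a * b * mutualEnergy k μ ν := by
  simp only [mutualEnergy, lintegral_smul_measure, smul_eq_mul]
  rw [lintegral_const_mul _ hk.lintegral_prod_right, mul_assoc]

lemma mutualEnergy_add_add (hk : Measurable (Function.uncurry k)) (μ ν μ' ν' : Measure X)
    [SFinite ν] [SFinite ν'] :
    mutualEnergy k (μ + μ') (ν + ν') = mutualEnergy k μ ν + mutualEnergy k μ ν'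
      + (mutualEnergy k μ' ν + mutualEnergy k μ' ν') := by
  simp only [mutualEnergy, lintegral_add_measure]
  rw [lintegral_add_left hk.lintegral_prod_right, lintegral_add_left hk.lintegral_prod_right]

lemma le_of_forall_perturbation {a b p q e : ℝ} (ha : 0 ≤ a) (hp : 0 ≤ p) (he : 0 ≤ e)
    (h : ∀ t : ℝ, 0 < t → t < 1 →
      a + b ≤ (1 - t) * (1 - t) * a + (1 - t) * t * p + (t * (1 - t) * p + t * t * e)
        + ((1 - t) * b + t * q)) : 2 * a + b ≤ 2 * p + q := by
  by_contra! hlt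
  set δ := 2 * a + b - (2 * p + q) with hδ
  have hδ0 : 0 < δ := by linarith
  have hs : 0 < δ + a + e + 1 := by linarith
  have ht0 : 0 < δ / (δ + a + e + 1) := by positivity
  have h1 := h (δ / (δ + a + e + 1)) ht0 (by rw [div_lt_one hs]; linarith)
  have hts : δ / (δ + a + e + 1) * (δ + a + e + 1) = δ := by field_simp
  generalize δ / (δ + a + e + 1) = t at *
  have h2 : t * (δ - t * (a + e - 2 * p)) ≤ 0 := by
    rw [hδ]; nlinarith
  have h3 : 0 < δ - t * (a + e - 2 * p) := by nlinarith
  nlinarith [mul_pos ht0 h3]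

/-- First-order optimality condition at a minimizer of `∬ k dμ dμ + ∫ U dμ`,
tested against a probability measure of finite energy. -/
lemma two_mul_mutualEnergy_add_lintegral_le (hk : Measurable (Function.uncurry k))
    (hsymm : ∀ x y, k x y = k y x) (U : X → ℝ≥0∞)
    (μ : Measure X) [IsProbabilityMeasure μ]
    (hmin : ∀ ν : Measure X, IsProbabilityMeasure ν →
      mutualEnergy k μ μ + ∫⁻ x, U x ∂μ ≤ mutualEnergy k ν ν + ∫⁻ x, U x ∂ν)
    (hfin : mutualEnergy k μ μ + ∫⁻ x, U x ∂μ ≠ ⊤)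
    (ν : Measure X) [IsProbabilityMeasure ν] (hν : mutualEnergy k ν ν ≠ ⊤) :
    2 * mutualEnergy k μ μ + ∫⁻ x, U x ∂μ ≤ 2 * mutualEnergy k ν μ + ∫⁻ x, U x ∂ν := by
  by_cases hp : mutualEnergy k ν μ = ⊤
  · simp [hp]
  by_cases hq : ∫⁻ x, U x ∂ν = ⊤
  · simp [hq]
  obtain ⟨ha, hb⟩ := ENNReal.add_ne_top.1 hfin
  have key : ∀ t : ℝ, 0 < t → t < 1 →
      mutualEnergy k μ μ + ∫⁻ x, U x ∂μ ≤
        ENNReal.ofReal (1 - t) * ENNReal.ofReal (1 - t) * mutualEnergy k μ μ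
          + ENNReal.ofReal (1 - t) * ENNReal.ofReal t * mutualEnergy k ν μ
          + (ENNReal.ofReal t * ENNReal.ofReal (1 - t) * mutualEnergy k ν μ
          + ENNReal.ofReal t * ENNReal.ofReal t * mutualEnergy k ν ν)
          + (ENNReal.ofReal (1 - t) * ∫⁻ x, U x ∂μ + ENNReal.ofReal t * ∫⁻ x, U x ∂ν) := by
    intro t ht0 ht1
    have h := hmin (ENNReal.ofReal (1 - t) • μ + ENNReal.ofReal t • ν) ⟨by
      simp only [Measure.coe_add, Measure.coe_smul, Pi.add_apply, Pi.smul_apply, measure_univ,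
        smul_eq_mul, mul_one]
      rw [← ENNReal.ofReal_add (by linarith) ht0.le]
      simp⟩
    rwa [mutualEnergy_add_add hk, mutualEnergy_smul_smul hk, mutualEnergy_smul_smul hk,
      mutualEnergy_smul_smul hk, mutualEnergy_smul_smul hk, mutualEnergy_comm hk hsymm μ ν,
      lintegral_add_measure, lintegral_smul_measure, lintegral_smul_measure] at h
  generalize mutualEnergy k μ μ = a at *
  generalize mutualEnergy k ν ν = e at *
  generalize mutualEnergy k ν μ = p at *
  generalize ∫⁻ x, U x ∂μ = b at *
  generalize ∫⁻ x, U x ∂ν = q at *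
  lift a to NNReal using ha
  lift b to NNReal using hb
  lift p to NNReal using hp
  lift q to NNReal using hq
  lift e to NNReal using hν
  have : 2 * (a : ℝ) + b ≤ 2 * p + q := by
    refine le_of_forall_perturbation (e := e) a.2 p.2 e.2 fun t ht0 ht1 ↦ ?_
    have h := key t ht0 ht1
    rw [ENNReal.ofReal, ENNReal.ofReal] at h
    norm_cast at h
    have h' := NNReal.coe_le_coe.2 h
    push_cast [Real.coe_toNNReal t ht0.le, Real.coe_toNNReal (1 - t) (by linarith)] at h'
    exact h'
  exact_mod_cast this

/-- The Frostman inequality cannot fail almost everywhere for a nontrivial finite measure of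
finite energy. -/
lemma measure_eq_zero_of_forall_mem_lt (hk : Measurable (Function.uncurry k))
    (hsymm : ∀ x y, k x y = k y x) {U : X → ℝ≥0∞}
    (μ : Measure X) [IsProbabilityMeasure μ]
    (hmin : ∀ ν : Measure X, IsProbabilityMeasure ν →
      mutualEnergy k μ μ + ∫⁻ x, U x ∂μ ≤ mutualEnergy k ν ν + ∫⁻ x, U x ∂ν)
    (hfin : mutualEnergy k μ μ + ∫⁻ x, U x ∂μ ≠ ⊤)
    (ν : Measure X) [IsFiniteMeasure ν] (hν : mutualEnergy k ν ν ≠ ⊤)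
    (hlt : ∀ᵐ x ∂ν, 2 * (∫⁻ y, k x y ∂μ) + U x < 2 * mutualEnergy k μ μ + ∫⁻ x, U x ∂μ) :
    ν = 0 := by
  by_contra h0
  have hu : ν Set.univ ≠ 0 := by simpa using h0
  have hi : (ν Set.univ)⁻¹ ≠ ⊤ := by simpa using h0
  have hP : IsProbabilityMeasure ((ν Set.univ)⁻¹ • ν) := ⟨by
    simp [ENNReal.inv_mul_cancel hu (measure_ne_top _ _)]⟩
  have hpot : Measurable fun x ↦ ∫⁻ y, k x y ∂μ := hk.lintegral_prod_right
  have h := two_mul_mutualEnergy_add_lintegral_le hk hsymm U μ hmin hfin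
    ((ν Set.univ)⁻¹ • ν) (by
      rw [mutualEnergy_smul_smul hk]
      exact ENNReal.mul_ne_top (ENNReal.mul_ne_top hi hi) hν)
  have hC : 2 * mutualEnergy k μ μ + ∫⁻ x, U x ∂μ ≠ ⊤ := by
    obtain ⟨ha, hb⟩ := ENNReal.add_ne_top.1 hfin
    exact ENNReal.add_ne_top.2 ⟨ENNReal.mul_ne_top (by simp) ha, hb⟩
  generalize 2 * mutualEnergy k μ μ + ∫⁻ x, U x ∂μ = C at *
  rw [mutualEnergy, ← lintegral_const_mul _ hpot, ← lintegral_add_left (hpot.const_mul _)] at h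
  refine h.not_gt ?_
  calc _ < ∫⁻ _, C ∂((ν Set.univ)⁻¹ • ν) := by
        refine lintegral_strict_mono hP.ne_zero aemeasurable_const (ne_top_of_le_ne_top hC ?_) ?_
        · refine (lintegral_mono_ae
            (Measure.ae_smul_measure (hlt.mono fun x hx ↦ hx.le) _)).trans ?_
          simp
        · exact Measure.ae_smul_measure hlt _
    _ = C := by simp

/-- Frostman's equality on the support of a minimizer. -/
lemma ae_two_mul_lintegral_add_eq (hk : Measurable (Function.uncurry k))
    (hsymm : ∀ x y, k x y = k y x) {U : X → ℝ≥0∞} (hU : Measurable U)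
    (μ : Measure X) [IsProbabilityMeasure μ]
    (hmin : ∀ ν : Measure X, IsProbabilityMeasure ν →
      mutualEnergy k μ μ + ∫⁻ x, U x ∂μ ≤ mutualEnergy k ν ν + ∫⁻ x, U x ∂ν)
    (hfin : mutualEnergy k μ μ + ∫⁻ x, U x ∂μ ≠ ⊤) :
    ∀ᵐ x ∂μ, 2 * (∫⁻ y, k x y ∂μ) + U x = 2 * mutualEnergy k μ μ + ∫⁻ x, U x ∂μ := by
  have hpot : Measurable fun x ↦ ∫⁻ y, k x y ∂μ := hk.lintegral_prod_right
  obtain ⟨ha, hb⟩ := ENNReal.add_ne_top.1 hfin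
  set C := 2 * mutualEnergy k μ μ + ∫⁻ x, U x ∂μ with hCdef
  have hC : C ≠ ⊤ := ENNReal.add_ne_top.2 ⟨ENNReal.mul_ne_top (by simp) ha, hb⟩
  have hA : MeasurableSet {x | 2 * (∫⁻ y, k x y ∂μ) + U x < C} :=
    measurableSet_lt ((hpot.const_mul _).add hU) measurable_const
  have hge : ∀ᵐ x ∂μ, C ≤ 2 * (∫⁻ y, k x y ∂μ) + U x := by
    simp only [ae_iff, not_le]
    rw [← Measure.restrict_eq_zero]
    refine measure_eq_zero_of_forall_mem_lt hk hsymm μ hmin hfin _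
      (ne_top_of_le_ne_top ha ?_) (ae_restrict_mem hA)
    exact lintegral_mono' Measure.restrict_le_self fun x ↦
      lintegral_mono' Measure.restrict_le_self le_rfl
  have := ae_eq_of_ae_le_of_lintegral_le hge (by simpa using hC)
    ((hpot.const_mul _).add hU).aemeasurable (by
      rw [lintegral_add_left (hpot.const_mul _), lintegral_const_mul _ hpot]
      simp [hCdef, mutualEnergy])
  exact this.mono fun x hx ↦ hx.symm

end MutualEnergy

section Coulomb

variable {d : ℕ}

lemma measurable_coulK : Measurable (coulK d) :=
  (ENNReal.measurable_ofReal.comp measurable_norm).pow_const _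

lemma coulK_sub_comm (x y : Esp d) : coulK d (x - y) = coulK d (y - x) := by
  simp only [coulK, norm_sub_rev]

lemma measurable_uncurry_coulK_sub :
    Measurable (Function.uncurry fun x y : Esp d ↦ coulK d (x - y)) :=
  measurable_coulK.comp (measurable_fst.sub measurable_snd)

lemma doubleEnergy_eq_mutualEnergy (μ : Measure (Esp d)) [SFinite μ] :
    doubleEnergy d μ = mutualEnergy (fun x y ↦ coulK d (x - y)) μ μ :=
  lintegral_prod _ measurable_uncurry_coulK_sub.aemeasurable

lemma setLIntegral_ball_coulK_ne_top (hd : 3 ≤ d) (r : ℝ) :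
    ∫⁻ x in Metric.ball (0 : Esp d) r, coulK d x ≠ ⊤ := by
  have : Nontrivial (Esp d) :=
    Module.nontrivial_of_finrank_pos (R := ℝ) (by rw [finrank_euclideanSpace_fin]; omega)
  have hint : IntegrableOn (fun x : Esp d ↦ ‖x‖ ^ (2 - (d : ℝ))) (Metric.ball 0 r) := by
    refine integrableOn_ball_of_norm_le_rpow (C := 1) (α := (d : ℝ) - 2) ?_ ?_ ?_ ?_
    · rw [finrank_euclideanSpace_fin]; omega
    · rw [finrank_euclideanSpace_fin]; linarith
    · refine ae_of_all _ fun x ↦ ?_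
      rw [Real.norm_of_nonneg (by positivity), one_mul, neg_sub]
    · exact (measurable_norm.pow_const _).aestronglyMeasurable
  refine ne_of_eq_of_ne ?_ hint.lintegral_lt_top.ne
  refine lintegral_congr_ae (ae_restrict_of_ae ?_)
  filter_upwards [Measure.ae_ne volume (0 : Esp d)] with x hx
  exact ENNReal.ofReal_rpow_of_pos (norm_pos_iff.2 hx)

lemma mutualEnergy_coulK_restrict_ne_top (hd : 3 ≤ d) {r : ℝ} {s : Set (Esp d)}
    (hs : s ⊆ Metric.ball 0 r) :
    mutualEnergy (fun x y ↦ coulK d (x - y)) (volume.restrict s) (volume.restrict s) ≠ ⊤ := by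
  set K := ∫⁻ x in Metric.ball (0 : Esp d) (r + r), coulK d x with hK
  have hpot : ∀ x ∈ Metric.ball (0 : Esp d) r,
      ∫⁻ y in Metric.ball (0 : Esp d) r, coulK d (x - y) ≤ K := by
    intro x hx
    rw [hK, ← lintegral_indicator measurableSet_ball, ← lintegral_indicator measurableSet_ball,
      ← lintegral_sub_left_eq_self (fun z ↦ (Metric.ball (0 : Esp d) (r + r)).indicator _ z) x]
    refine lintegral_mono fun y ↦ ?_
    by_cases hy : y ∈ Metric.ball (0 : Esp d) r
    · have hxy : x - y ∈ Metric.ball (0 : Esp d) (r + r) := by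
        rw [mem_ball_zero_iff] at *
        exact (norm_sub_le x y).trans_lt (add_lt_add hx hy)
      simp [hy, hxy, Set.indicator_of_mem]
    · simp [hy]
  have hle : mutualEnergy (fun x y ↦ coulK d (x - y)) (volume.restrict s) (volume.restrict s)
      ≤ ∫⁻ _ in Metric.ball (0 : Esp d) r, K := by
    refine (lintegral_mono' (Measure.restrict_mono_set _ hs) fun x ↦
      lintegral_mono' (Measure.restrict_mono_set _ hs) le_rfl).trans ?_
    exact setLIntegral_mono measurable_const hpot
  refine ne_top_of_le_ne_top ?_ hle
  rw [setLIntegral_const]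
  exact ENNReal.mul_ne_top (setLIntegral_ball_coulK_ne_top hd _) measure_ball_lt_top.ne

end Coulomb

lemma EReal.coe_toENNReal_add_sub {v : EReal} {m : ℝ} (h : ((-m : ℝ) : EReal) ≤ v) :
    (((v + m).toENNReal : ℝ≥0∞) : EReal) - m = v := by
  induction v with
  | bot => simp at h
  | top => simp
  | coe v =>
    have h' : -m ≤ v := by exact_mod_cast h
    rw [EReal.coe_toENNReal (by exact_mod_cast (by linarith : (0 : ℝ) ≤ v + m))]
    norm_cast
    ring

lemma eIntE_coe_sub {X : Type*} [MeasurableSpace X] (μ : Measure X) [IsProbabilityMeasure μ]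
    {U : X → ℝ≥0∞} (hU : Measurable U) {m : ℝ} (hm : 0 ≤ m) :
    eIntE μ (fun x ↦ (U x : EReal) - m) = ((∫⁻ x, U x ∂μ : ℝ≥0∞) : EReal) - m := by
  have hpos : ∀ u : ℝ≥0∞, (if (u : EReal) - m = ⊤ then ⊤
      else ENNReal.ofReal ((u : EReal) - m).toReal) = u - ENNReal.ofReal m := by
    intro u
    induction u with
    | top => simp
    | coe u =>
      have h : ((u : ℝ≥0∞) : EReal) - m = ((u - m : ℝ) : EReal) := by norm_cast
      rw [h, if_neg (EReal.coe_ne_top _), EReal.toReal_coe, ENNReal.ofReal_sub _ hm,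
        ENNReal.ofReal_coe_nnreal]
  have hneg : ∀ u : ℝ≥0∞, (if (u : EReal) - m = ⊥ then ⊤
      else ENNReal.ofReal (-((u : EReal) - m)).toReal) = ENNReal.ofReal m - u := by
    intro u
    induction u with
    | top => simp
    | coe u =>
      have h : ((u : ℝ≥0∞) : EReal) - m = ((u - m : ℝ) : EReal) := by norm_cast
      rw [h, if_neg (EReal.coe_ne_bot _), ← EReal.coe_neg, EReal.toReal_coe, neg_sub,
        ENNReal.ofReal_sub _ u.coe_nonneg, ENNReal.ofReal_coe_nnreal]
  simp only [eIntE, hpos, hneg]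
  have hsum : ∫⁻ x, (U x - ENNReal.ofReal m) ∂μ + ENNReal.ofReal m
      = ∫⁻ x, U x ∂μ + ∫⁻ x, (ENNReal.ofReal m - U x) ∂μ := by
    rw [← lintegral_add_left hU]
    conv_lhs => rw [← mul_one (ENNReal.ofReal m), ← measure_univ (μ := μ), ← lintegral_const]
    rw [← lintegral_add_right _ measurable_const]
    refine lintegral_congr fun x ↦ ?_
    simp [tsub_add_eq_max, add_tsub_eq_max]
  have hN : ∫⁻ x, (ENNReal.ofReal m - U x) ∂μ ≠ ⊤ := by
    refine ne_top_of_le_ne_top ?_ (lintegral_mono fun x ↦ tsub_le_self)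
    simp
  generalize ∫⁻ x, (ENNReal.ofReal m - U x) ∂μ = N at *
  generalize ∫⁻ x, (U x - ENNReal.ofReal m) ∂μ = P at *
  generalize ∫⁻ x, U x ∂μ = B at *
  lift m to NNReal using hm
  rw [ENNReal.ofReal_coe_nnreal] at hsum
  lift N to NNReal using hN
  induction P with
  | top =>
    induction B with
    | top => norm_cast
    | coe B => simp at hsum; norm_cast at hsum
  | coe P =>
    induction B with
    | top => simp at hsum
    | coe B =>
      have h : (P : ℝ) + m = B + N := by exact_mod_cast hsum
      have h' : (P : ℝ) - N = B - m := by linarith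
      exact congrArg ((↑) : ℝ → EReal) h'

lemma strictMono_coe_mul_half_sub (r : ℝ) :
    StrictMono fun w : ℝ≥0∞ ↦ (w : EReal) * ((2⁻¹ : ℝ) : EReal) - r := by
  intro v w hvw
  lift v to NNReal using hvw.ne_top
  have hcoe : ∀ z : NNReal, ((z : ℝ≥0∞) : EReal) * ((2⁻¹ : ℝ) : EReal) - r
      = ((z * 2⁻¹ - r : ℝ) : EReal) := fun z ↦ rfl
  beta_reduce
  rw [hcoe]
  induction w with
  | top =>
    rw [EReal.coe_ennreal_top, EReal.top_mul_coe_of_pos (by norm_num), EReal.top_sub_coe]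
    exact EReal.coe_lt_top _
  | coe w =>
    rw [hcoe, EReal.coe_lt_coe_iff]
    have : (v : ℝ) < w := by exact_mod_cast hvw
    linarith

lemma coe_add_sub_mul_half (p u : ℝ≥0∞) (m : ℝ) :
    (p : EReal) + ((u : EReal) - m) * ((2⁻¹ : ℝ) : EReal)
      = ((2 * p + u : ℝ≥0∞) : EReal) * ((2⁻¹ : ℝ) : EReal) - ((m * 2⁻¹ : ℝ) : EReal) := by
  have htop : (⊤ : EReal) * ((2⁻¹ : ℝ) : EReal) = ⊤ := EReal.top_mul_coe_of_pos (by norm_num)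
  induction u with
  | top =>
    rw [add_top, EReal.coe_ennreal_top, EReal.top_sub_coe, htop, EReal.top_sub_coe,
      EReal.add_top_of_ne_bot (EReal.coe_ennreal_ne_bot p)]
  | coe u =>
    have hu : (((u : ℝ≥0∞) : EReal) - m) * ((2⁻¹ : ℝ) : EReal) = (((u - m) * 2⁻¹ : ℝ) : EReal) :=
      rfl
    rw [hu]
    induction p with
    | top =>
      rw [ENNReal.mul_top two_ne_zero, top_add, EReal.coe_ennreal_top, htop, EReal.top_sub_coe,
        EReal.top_add_coe]
    | coe p =>
      have h : (p : ℝ) + (u - m) * 2⁻¹ = (2 * p + u : NNReal) * 2⁻¹ - m * 2⁻¹ := by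
        push_cast; ring
      exact congrArg ((↑) : ℝ → EReal) h

lemma coe_add_coe_sub_sub_mul_half (A : EReal) {B : ℝ≥0∞} (hB : B ≠ ⊤) (m : ℝ) :
    A + ((B : EReal) - m) - ((B : EReal) - m) * ((2⁻¹ : ℝ) : EReal)
      = A + ((B : EReal) - m) * ((2⁻¹ : ℝ) : EReal) := by
  lift B to NNReal using hB
  rw [sub_eq_add_neg _ (_ * _), add_assoc]
  congr 1
  have h : (B : ℝ) - m + -((B - m) * 2⁻¹) = (B - m) * 2⁻¹ := by ring
  exact congrArg ((↑) : ℝ → EReal) h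

/-- Frostman / Euler–Lagrange characterization of the equilibrium measure:
`h^{μ_V} + V/2 ≥ c` Lebesgue-a.e., and `h^{μ_V} + V/2 = c` `μ_V`-a.e., where
`c = I_V(μ_V) - (1/2) ∫ V dμ_V`. -/
theorem statement_1 (d : ℕ) (hd : 3 ≤ d) (V : Esp d → EReal)
    (hlsc : LowerSemicontinuous V)
    (hbd : ∃ c : ℝ, ∀ x, (c : EReal) ≤ V x)
    (hfin : 0 < volume {x : Esp d | V x ≠ ⊤})
    (hgrowth : Tendsto
      (fun x : Esp d => V x * ((2⁻¹ : ℝ) : EReal) + ((‖x‖ ^ (2 - (d : ℝ)) : ℝ) : EReal))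
      (cocompact (Esp d)) (𝓝 (⊤ : EReal)))
    (μV : Measure (Esp d)) (hprob : IsProbabilityMeasure μV)
    (hmin : ∀ ν : Measure (Esp d), IsProbabilityMeasure ν → IV d V μV ≤ IV d V ν)
    (huniq : ∀ ν : Measure (Esp d), IsProbabilityMeasure ν → IV d V ν = IV d V μV → ν = μV) :
    (∀ᵐ x ∂(volume : Measure (Esp d)),
        IV d V μV - eIntE μV V * ((2⁻¹ : ℝ) : EReal)
          ≤ (potC d μV x : EReal) + V x * ((2⁻¹ : ℝ) : EReal)) ∧
    (∀ᵐ x ∂μV,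
        (potC d μV x : EReal) + V x * ((2⁻¹ : ℝ) : EReal)
          = IV d V μV - eIntE μV V * ((2⁻¹ : ℝ) : EReal)) := by
  obtain ⟨m, hm0, hm⟩ : ∃ m : ℝ, 0 ≤ m ∧ ∀ x, ((-m : ℝ) : EReal) ≤ V x := by
    obtain ⟨c, hc⟩ := hbd
    refine ⟨|c|, abs_nonneg c, fun x ↦ le_trans ?_ (hc x)⟩
    exact_mod_cast neg_abs_le c
  set U : Esp d → ℝ≥0∞ := fun x ↦ (V x + m).toENNReal with hUdef
  have hU : Measurable U := (hlsc.measurable.add_const _).ereal_toENNReal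
  have hVU : V = fun x ↦ (U x : EReal) - m :=
    funext fun x ↦ (EReal.coe_toENNReal_add_sub (hm x)).symm
  have hk := measurable_uncurry_coulK_sub (d := d)
  have hpot : Measurable fun x ↦ ∫⁻ y, coulK d (x - y) ∂μV := hk.lintegral_prod_right
  have hint : ∀ ν : Measure (Esp d), IsProbabilityMeasure ν →
      eIntE ν V = ((∫⁻ x, U x ∂ν : ℝ≥0∞) : EReal) - m := by
    intro ν _
    rw [hVU, eIntE_coe_sub ν hU hm0]
  have hIV : ∀ ν : Measure (Esp d), IsProbabilityMeasure ν →
      IV d V ν = ((mutualEnergy (fun x y ↦ coulK d (x - y)) ν ν + ∫⁻ x, U x ∂ν : ℝ≥0∞) : EReal)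
        - m := by
    intro ν hν
    rw [IV, hint ν hν, doubleEnergy_eq_mutualEnergy, EReal.coe_ennreal_add, sub_eq_add_neg,
      sub_eq_add_neg, add_assoc]
  have hmin' : ∀ ν : Measure (Esp d), IsProbabilityMeasure ν →
      mutualEnergy (fun x y ↦ coulK d (x - y)) μV μV + ∫⁻ x, U x ∂μV
        ≤ mutualEnergy (fun x y ↦ coulK d (x - y)) ν ν + ∫⁻ x, U x ∂ν := by
    intro ν hν
    have h := hmin ν hν
    rw [hIV μV hprob, hIV ν hν] at h
    have h' := add_le_add_left h (m : EReal)
    simp only [EReal.sub_add_cancel] at h'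
    exact EReal.coe_ennreal_le_coe_ennreal_iff.1 h'
  have hfin' : mutualEnergy (fun x y ↦ coulK d (x - y)) μV μV + ∫⁻ x, U x ∂μV ≠ ⊤ := by
    obtain ⟨n, hn⟩ : ∃ n : ℕ, volume ({x | U x ≤ n} ∩ Metric.ball 0 n) ≠ 0 := by
      by_contra! h
      refine hfin.ne' (measure_mono_null (fun x hx ↦ ?_) (measure_iUnion_null h))
      have hUx : U x ≠ ⊤ := by
        refine EReal.toENNReal_ne_top_iff.2 ?_
        exact EReal.add_ne_top hx (EReal.coe_ne_top _)
      obtain ⟨a, ha⟩ := exists_nat_ge (U x).toReal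
      obtain ⟨b, hb⟩ := exists_nat_gt ‖x‖
      refine Set.mem_iUnion.2 ⟨max a b, ?_, ?_⟩
      · change U x ≤ _
        rw [← ENNReal.ofReal_toReal hUx]
        refine (ENNReal.ofReal_le_ofReal ha).trans ?_
        rw [ENNReal.ofReal_natCast]
        exact_mod_cast le_max_left a b
      · rw [mem_ball_zero_iff]
        exact hb.trans_le (by exact_mod_cast le_max_right a b)
    set s := {x | U x ≤ n} ∩ Metric.ball (0 : Esp d) n
    have hsm : MeasurableSet s := (measurableSet_le hU measurable_const).inter measurableSet_ball
    have hs_top : volume s ≠ ⊤ :=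
      ((measure_mono Set.inter_subset_right).trans_lt measure_ball_lt_top).ne
    have hi : (volume s)⁻¹ ≠ ⊤ := ENNReal.inv_ne_top.2 hn
    have hP : IsProbabilityMeasure ((volume s)⁻¹ • volume.restrict s) := ⟨by
      simp [ENNReal.inv_mul_cancel hn hs_top]⟩
    refine ne_top_of_le_ne_top ?_ (hmin' _ hP)
    rw [mutualEnergy_smul_smul hk, lintegral_smul_measure]
    refine ENNReal.add_ne_top.2 ⟨ENNReal.mul_ne_top (ENNReal.mul_ne_top hi hi)
      (mutualEnergy_coulK_restrict_ne_top hd Set.inter_subset_right), ENNReal.mul_ne_top hi ?_⟩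
    refine ne_top_of_le_ne_top ?_ (setLIntegral_mono measurable_const fun x hx ↦ hx.1)
    rw [setLIntegral_const]
    exact ENNReal.mul_ne_top (ENNReal.natCast_ne_top n) hs_top
  obtain ⟨hA, hB⟩ := ENNReal.add_ne_top.1 hfin'
  have hVx : ∀ x, V x = (U x : EReal) - m := fun x ↦ congrFun hVU x
  rw [IV, hint μV hprob, doubleEnergy_eq_mutualEnergy]
  simp only [hVx, coe_add_coe_sub_sub_mul_half _ hB, coe_add_sub_mul_half,
    (strictMono_coe_mul_half_sub _).le_iff_le, (strictMono_coe_mul_half_sub _).injective.eq_iff]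
  refine ⟨?_, ae_two_mul_lintegral_add_eq hk coulK_sub_comm hU μV hmin' hfin'⟩
  simp only [ae_iff, not_le]
  set A := {x | 2 * potC d μV x + U x
    < 2 * mutualEnergy (fun x y ↦ coulK d (x - y)) μV μV + ∫⁻ x, U x ∂μV}
  have hAm : MeasurableSet A := measurableSet_lt ((hpot.const_mul _).add hU) measurable_const
  refine measure_mono_null (t := ⋃ n : ℕ, A ∩ Metric.ball 0 n) (fun x hx ↦ ?_)
    (measure_iUnion_null fun n ↦ ?_)
  · obtain ⟨n, hn⟩ := exists_nat_gt ‖x‖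
    exact Set.mem_iUnion.2 ⟨n, hx, mem_ball_zero_iff.2 hn⟩
  · have : IsFiniteMeasure (volume.restrict (A ∩ Metric.ball (0 : Esp d) n)) :=
      isFiniteMeasure_restrict.2
        ((measure_mono Set.inter_subset_right).trans_lt measure_ball_lt_top).ne
    rw [← Measure.restrict_eq_zero]
    exact measure_eq_zero_of_forall_mem_lt hk coulK_sub_comm μV hmin' hfin' _
      (mutualEnergy_coulK_restrict_ne_top hd Set.inter_subset_right)
      ((ae_restrict_mem (hAm.inter measurableSet_ball)).mono fun x hx ↦ hx.1)
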